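/- Let G = (X,E) be a tree without dead ends. For a linear functional λ ∈ D'(𝔓) the following are equivalent: (1) there exists T ∈ D'(Ω) with λ = B*T; (2) L'λ = λ. Consequently, the pullback B* is a linear isomorphism from D'(Ω) onto the space {λ ∈ D'(𝔓) | L'λ = λ} of fixed points of the transpose transfer operator. -/

import Mathlib

open Function Set
open scoped Classical

namespace GraphQCC

variable {X : Type} (G : SimpleGraph X)

/-- The set of directed edges of a (symmetric, loopless) graph. -/
abbrev DE := {p : X × X // G.Adj p.1 p.2}

variable {G}

/-- Initial vertex of a directed edge. -/
def ini (e : DE G) : X := e.1.1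

/-- Terminal vertex of a directed edge. -/
def ter (e : DE G) : X := e.1.2

/-- Opposite edge. -/
def op (e : DE G) : DE G := ⟨(e.1.2, e.1.1), e.2.symm⟩

variable (G)

/-- Degree of a vertex: the number of directed edges starting at it. -/
noncomputable def deg (x : X) : ℕ := Set.ncard {e : DE G | ini e = x}

/-- The graph is locally finite: every vertex has finite degree. -/
def LocFin : Prop := ∀ x : X, {e : DE G | ini e = x}.Finite

/-- The edge Laplacian. -/
noncomputable def edgeLap (f : DE G → ℂ) (e : DE G) : ℂ :=
  ∑ᶠ e' ∈ {e' : DE G | ini e' = ter e ∧ e' ≠ op e}, f e'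

/-- The `z`-eigenspace of the edge Laplacian, as a set of functions on directed edges. -/
def edgeEig (z : ℂ) : Set (DE G → ℂ) := {f | ∀ e, edgeLap G f e = z * f e}

/-- The edge inversion operator Ξ. -/
def Xi (f : DE G → ℂ) (e : DE G) : ℂ := f (op e)

/-- The operator Σ (sum over edges with the same initial point). -/
noncomputable def Sig (f : DE G → ℂ) (e : DE G) : ℂ :=
  ∑ᶠ e' ∈ {e' : DE G | ini e' = ini e}, f e'

/-- Edges pointing away from a vertex `o`. -/
def away (o : X) : Set (DE G) := {e | G.dist o (ter e) = G.dist o (ini e) + 1}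

/-- The edge Laplacian on functions on the edges pointing away from `o`. -/
noncomputable def edgeLapAway (o : X) (f : ↥(away G o) → ℂ) (e : ↥(away G o)) : ℂ :=
  ∑ᶠ e' ∈ {e' : ↥(away G o) | ini e'.1 = ter e.1 ∧ e'.1 ≠ op e.1}, f e'

/-- The `z`-eigenspace of the edge Laplacian on edges pointing away from `o`. -/
def edgeEigAway (o : X) (z : ℂ) : Set (↥(away G o) → ℂ) :=
  {f | ∀ e, edgeLapAway G o f e = z * f e}

/-! ## Boundary at infinity -/

/-- A ray: an infinite non-backtracking chain of vertices. -/
def IsRay (r : ℕ → X) : Prop := (∀ n, G.Adj (r n) (r (n + 1))) ∧ ∀ n, r (n + 2) ≠ r n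

abbrev Ray := {r : ℕ → X // IsRay G r}

/-- Two rays are equivalent if they share infinitely many vertices. -/
def RayRel (r r' : Ray G) : Prop := (Set.range r.1 ∩ Set.range r'.1).Infinite

/-- The boundary at infinity: equivalence classes of rays. -/
def Boundary := Quot (RayRel G)

/-- The set `∂₊ e` of boundary points reachable by a non-backtracking chain starting with `e`. -/
def plusBd (e : DE G) : Set (Boundary G) :=
  {ω | ∃ r : Ray G, Quot.mk (RayRel G) r = ω ∧ r.1 0 = ini e ∧ r.1 1 = ter e}

/-- The topology on the boundary generated by the sets `∂₊ e`. -/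
instance : TopologicalSpace (Boundary G) :=
  TopologicalSpace.generateFrom {s | ∃ e : DE G, s = plusBd G e}

/-- The space of locally constant functions on the boundary. -/
noncomputable def Clc : Submodule ℂ (Boundary G → ℂ) where
  carrier := {f | IsLocallyConstant f}
  add_mem' hf hg := hf.comp₂ hg (· + ·)
  zero_mem' := IsLocallyConstant.const 0
  smul_mem' c f hf := hf.comp (c * ·)

/-- `D'(Ω)`: the algebraic dual of the space of locally constant functions on the boundary. -/
abbrev DualB := Module.Dual ℂ ↥(Clc G)

/-- Pairing of a functional on `C^lc(Ω)` with a function on the boundary. -/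
noncomputable def pairB (μ : DualB G) (g : Boundary G → ℂ) : ℂ :=
  if h : IsLocallyConstant g then μ ⟨g, h⟩ else 0

/-- The horocycle bracket `⟨x, ω⟩` with respect to the base point `o`: the unique integer `k`
such that `d(x, r n) = n - k` for every ray `r` from `o` representing `ω` and all large `n`. -/
noncomputable def horo (o x : X) (ω : Boundary G) : ℤ :=
  if h : ∃ k : ℤ, ∀ r : Ray G, Quot.mk (RayRel G) r = ω → r.1 0 = o →
      ∃ N : ℕ, ∀ n : ℕ, N ≤ n → (G.dist x (r.1 n) : ℤ) = (n : ℤ) - k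
  then h.choose else 0

/-- The scalar Poisson transform. -/
noncomputable def poisson (o : X) (z : ℂ) (μ : DualB G) (x : X) : ℂ :=
  pairB G μ fun ω => z ^ horo G o x ω

/-- The edge Poisson transform. -/
noncomputable def edgePoisson (o : X) (z : ℂ) (μ : DualB G) (e : DE G) : ℂ :=
  pairB G μ fun ω => z ^ horo G o (ini e) ω * Set.indicator (plusBd G e) 1 ω

/-! ## The shift space of non-backtracking chains of edges -/

/-- An infinite concatenated non-backtracking sequence of directed edges. -/
def IsChainSeq (c : ℕ → DE G) : Prop :=
  ∀ i, ter (c i) = ini (c (i + 1)) ∧ ter (c (i + 1)) ≠ ini (c i)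

/-- The shift space `𝔓`. -/
abbrev ChainSp := {c : ℕ → DE G // IsChainSeq G c}

/-- The one-sided shift on chains. -/
def shift (c : ChainSp G) : ChainSp G := ⟨fun n => c.1 (n + 1), fun i => c.2 (i + 1)⟩

/-- The district (cylinder) topology on the shift space. -/
instance : TopologicalSpace (ChainSp G) :=
  TopologicalSpace.generateFrom
    {s | ∃ (c₀ : ChainSp G) (n : ℕ), s = {c : ChainSp G | ∀ i ≤ n, c.1 i = c₀.1 i}}

/-- The Ruelle transfer operator. -/
noncomputable def transfer (F : ChainSp G → ℂ) (c : ChainSp G) : ℂ :=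
  ∑ᶠ c' ∈ {c' : ChainSp G | shift G c' = c}, F c'

/-- Functions on chains depending only on the first `N` edges. -/
def cylFun (N : ℕ) : Set (ChainSp G → ℂ) :=
  {F | ∀ c c' : ChainSp G, (∀ i < N, c.1 i = c'.1 i) → F c = F c'}

/-- The ray of initial vertices of a chain of edges. -/
def toRay (c : ChainSp G) : Ray G :=
  ⟨fun n => ini (c.1 n), by
    refine ⟨fun n => ?_, fun n => ?_⟩
    · have h1 : ter (c.1 n) = ini (c.1 (n + 1)) := (c.2 n).1
      have h2 : G.Adj (ini (c.1 n)) (ter (c.1 n)) := (c.1 n).2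
      rwa [h1] at h2
    · have h1 : ter (c.1 (n + 1)) = ini (c.1 (n + 2)) := (c.2 (n + 1)).1
      have h2 : ter (c.1 (n + 1)) ≠ ini (c.1 n) := (c.2 n).2
      rwa [h1] at h2⟩

/-- The endpoint map `B : 𝔓 → Ω`. -/
def endB (c : ChainSp G) : Boundary G := Quot.mk (RayRel G) (toRay G c)

/-- The pushforward `B_⋆` by fiber summation. -/
noncomputable def push (f : ChainSp G → ℂ) (ω : Boundary G) : ℂ :=
  ∑ᶠ c ∈ {c : ChainSp G | endB G c = ω}, f c

/-- The space of locally constant compactly supported functions on the shift space. -/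
noncomputable def CcP : Submodule ℂ (ChainSp G → ℂ) where
  carrier := {F | IsLocallyConstant F ∧ HasCompactSupport F}
  add_mem' hf hg := ⟨hf.1.comp₂ hg.1 (· + ·), hf.2.add hg.2⟩
  zero_mem' := ⟨IsLocallyConstant.const 0, HasCompactSupport.zero⟩
  smul_mem' c f hf := ⟨hf.1.comp (c * ·),
    hf.2.mono fun x hx h0 => hx (by simp [h0])⟩

/-- `D'(𝔓)`: the algebraic dual of `C^lc_c(𝔓)`. -/
abbrev DualP := Module.Dual ℂ ↥(CcP G)

/-- Pairing of a functional on `C^lc_c(𝔓)` with a function on the shift space. -/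
noncomputable def pairP (lam : DualP G) (g : ChainSp G → ℂ) : ℂ :=
  if h : g ∈ CcP G then lam ⟨g, h⟩ else 0

/-- The space of locally constant functions on the shift space (for finite graphs this is
`C^lc_c(𝔓)` since `𝔓` is compact). -/
noncomputable def ClcP : Submodule ℂ (ChainSp G → ℂ) where
  carrier := {F | IsLocallyConstant F}
  add_mem' hf hg := hf.comp₂ hg (· + ·)
  zero_mem' := IsLocallyConstant.const 0
  smul_mem' c f hf := hf.comp (c * ·)

/-- The dual of `C^lc(𝔓)`. -/
abbrev DualPc := Module.Dual ℂ ↥(ClcP G)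

/-- Pairing of a functional on `C^lc(𝔓)` with a function on the shift space. -/
noncomputable def pairPc (lam : DualPc G) (g : ChainSp G → ℂ) : ℂ :=
  if h : IsLocallyConstant g then lam ⟨g, h⟩ else 0

/-! ## Vertex Laplacian -/

/-- The vertex Laplacian (averaging over neighbors). -/
noncomputable def vertexLap (f : X → ℂ) (x : X) : ℂ :=
  ((deg G x : ℂ))⁻¹ * ∑ᶠ e ∈ {e : DE G | ini e = x}, f (ter e)

/-- The function `χ(z)(x) = (z + q_x z⁻¹)/(q_x + 1)`. -/
noncomputable def chi (z : ℂ) (x : X) : ℂ :=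
  (z + ((deg G x : ℂ) - 1) * z⁻¹) / (deg G x : ℂ)

/-- The `χ(z)`-eigenspace of the vertex Laplacian. -/
def vertexEig (z : ℂ) : Set (X → ℂ) := {f | ∀ x, vertexLap G f x = chi G z x * f x}

/-! ## Miscellaneous -/

/-- Two subsets of complex vector spaces (in practice: subspaces) are linearly isomorphic. -/
def AreLinIso {M N : Type} [AddCommMonoid M] [Module ℂ M] [AddCommMonoid N] [Module ℂ N]
    (A : Set M) (B : Set N) : Prop :=
  ∃ F : M → N, Set.BijOn F A B ∧ (∀ a ∈ A, ∀ b ∈ A, F (a + b) = F a + F b) ∧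
    ∀ (c : ℂ), ∀ a ∈ A, F (c • a) = c • F a

/-- The `z`-eigenspace of the edge Laplacian as a submodule (for a locally finite graph). -/
noncomputable def edgeEigSub (hlf : LocFin G) (z : ℂ) : Submodule ℂ (DE G → ℂ) where
  carrier := edgeEig G z
  add_mem' := by
    intro f g hf hg e
    have hS : {e' : DE G | ini e' = ter e ∧ e' ≠ op e}.Finite :=
      (hlf (ter e)).subset fun _ h => h.1
    have : edgeLap G (f + g) e = edgeLap G f e + edgeLap G g e := by
      simpa [edgeLap] using finsum_mem_add_distrib (f := f) (g := g) hS
    rw [this, hf e, hg e, Pi.add_apply, mul_add]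
  zero_mem' := by
    intro e
    simp [edgeLap]
  smul_mem' := by
    intro c f hf e
    have hS : {e' : DE G | ini e' = ter e ∧ e' ≠ op e}.Finite :=
      (hlf (ter e)).subset fun _ h => h.1
    have : edgeLap G (c • f) e = c * edgeLap G f e := by
      simp only [edgeLap, Pi.smul_apply, smul_eq_mul]
      rw [finsum_mem_eq_finite_toFinset_sum _ hS, finsum_mem_eq_finite_toFinset_sum _ hS,
        Finset.mul_sum]
    rw [Pi.smul_apply, smul_eq_mul, this, hf e]; ring

/-- The cyclomatic number of a finite graph, as an integer. -/
noncomputable def cyclo : ℤ := (Nat.card G.edgeSet : ℤ) - (Nat.card X : ℤ) + 1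

/-- 2-colorability. -/
def TwoColorable : Prop := ∃ col : X → Bool, ∀ x y : X, G.Adj x y → col x ≠ col y


section Tree

variable {G}

/-- In a rooted tree, a vertex has at most one neighbor closer to the root. -/
theorem parent_unique (hT : G.IsTree) {o u v w : X}
    (hu : G.Adj u v) (hw : G.Adj w v)
    (du : G.dist o v = G.dist o u + 1) (dw : G.dist o v = G.dist o w + 1) : u = w := by
  obtain ⟨p, hp⟩ := hT.connected.exists_walk_length_eq_dist o u
  obtain ⟨q, hq⟩ := hT.connected.exists_walk_length_eq_dist o w
  have h1 : (p.concat hu).IsPath :=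
    SimpleGraph.Walk.isPath_of_length_eq_dist _ (by simp [hp, du])
  have h2 : (q.concat hw).IsPath :=
    SimpleGraph.Walk.isPath_of_length_eq_dist _ (by simp [hq, dw])
  obtain ⟨h, -⟩ := SimpleGraph.Walk.concat_inj ((hT.existsUnique_path o v).unique h1 h2)
  exact h

theorem IsRay.shift_add {r : ℕ → X} (h : IsRay G r) (a : ℕ) : IsRay G fun n => r (a + n) :=
  ⟨fun n => h.1 (a + n), fun n => h.2 (a + n)⟩

theorem IsRay.dist_zero (hT : G.IsTree) {r : ℕ → X} (h : IsRay G r) (n : ℕ) :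
    G.dist (r 0) (r n) = n := by
  suffices ∀ n, G.dist (r 0) (r n) = n ∧ G.dist (r 0) (r (n + 1)) = n + 1 from (this n).1
  intro n
  induction n with
  | zero => exact ⟨by simp, SimpleGraph.dist_eq_one_iff_adj.2 (h.1 0)⟩
  | succ n ih =>
    refine ⟨ih.2, ?_⟩
    rcases hT.dist_eq_dist_add_one_of_adj (r 0) (h.1 (n + 1)) with h1 | h1
    · exact absurd (parent_unique hT (h.1 (n + 1)).symm (h.1 n) h1
        (by omega)) (h.2 n)
    · rw [h1, ih.2]

theorem IsRay.injective (hT : G.IsTree) {r : ℕ → X} (h : IsRay G r) : Injective r := by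
  intro a b hab
  rw [← h.dist_zero hT a, ← h.dist_zero hT b, hab]

/-- Two rays with the same origin that share a vertex agree up to that vertex. -/
theorem IsRay.eq_of_le (hT : G.IsTree) {r s : ℕ → X} (hr : IsRay G r) (hs : IsRay G s)
    (h0 : r 0 = s 0) {i j : ℕ} (hij : r i = s j) : i = j ∧ ∀ k ≤ i, r k = s k := by
  have hij' : i = j := by
    rw [← hr.dist_zero hT i, ← hs.dist_zero hT j, h0, hij]
  subst hij'
  refine ⟨rfl, ?_⟩
  induction i with
  | zero => intro k hk; obtain rfl : k = 0 := by omega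
            exact h0
  | succ i ih =>
    have h1 : r i = s i := by
      refine parent_unique hT (o := r 0) (hr.1 i) (hij ▸ hs.1 i) ?_ ?_
      · rw [hr.dist_zero hT, hr.dist_zero hT]
      · rw [hr.dist_zero hT, h0, hs.dist_zero hT]
    intro k hk
    rcases Nat.lt_or_ge i k with h | h
    · obtain rfl : k = i + 1 := by omega
      exact hij
    · exact ih h1 k h

theorem RayRel.exists_tail_eq (hT : G.IsTree) {r s : Ray G} (h : RayRel G r s) :
    ∃ m n, ∀ k, r.1 (m + k) = s.1 (n + k) := by
  obtain ⟨_, ⟨a, rfl⟩, ⟨b, hb⟩⟩ := h.nonempty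
  refine ⟨a, b, fun k => ?_⟩
  obtain ⟨_, ⟨⟨i, rfl⟩, ⟨j, hj⟩⟩, hw⟩ := h.exists_notMem_finite
    (((finite_Iic (a + k)).image r.1).union ((finite_Iic (b + k)).image s.1))
  rw [mem_union, not_or] at hw
  have hi : a + k < i := by
    by_contra hc
    exact hw.1 ⟨i, not_lt.1 hc, rfl⟩
  have hj' : b + k < j := by
    by_contra hc
    exact hw.2 ⟨j, not_lt.1 hc, hj⟩
  refine ((r.2.shift_add a).eq_of_le hT (s.2.shift_add b) (i := i - a) (j := j - b)
    (by simpa using hb.symm) ?_).2 k (by omega)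
  simp only [show a + (i - a) = i by omega, show b + (j - b) = j by omega, hj]

theorem exists_tail_eq_of_mk_eq (hT : G.IsTree) {r s : Ray G}
    (h : Quot.mk (RayRel G) r = Quot.mk (RayRel G) s) :
    ∃ m n, ∀ k, r.1 (m + k) = s.1 (n + k) := by
  replace h := Quot.eqvGen_exact h
  induction h with
  | rel _ _ h => exact h.exists_tail_eq hT
  | refl _ => exact ⟨0, 0, fun _ => rfl⟩
  | symm _ _ _ ih =>
    obtain ⟨m, n, h⟩ := ih
    exact ⟨n, m, fun k => (h k).symm⟩
  | trans r s t _ _ ih1 ih2 =>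
    obtain ⟨m, n, h1⟩ := ih1
    obtain ⟨q, p, h2⟩ := ih2
    refine ⟨m + q, p + n, fun k => ?_⟩
    rw [add_assoc, h1, add_assoc, ← h2, ← add_assoc, ← add_assoc, add_comm n q]

/-! ### Chains as pairs of an initial vertex and an endpoint -/

theorem DE.ext {e e' : DE G} (h1 : ini e = ini e') (h2 : ter e = ter e') : e = e' :=
  Subtype.ext (Prod.ext h1 h2)

/-- The chain of consecutive edges of a ray. -/
def ofRay (r : Ray G) : ChainSp G :=
  ⟨fun n => ⟨(r.1 n, r.1 (n + 1)), r.2.1 n⟩, fun i => ⟨rfl, r.2.2 i⟩⟩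

/-- Prepend an edge to a chain. -/
def cons (e : DE G) (c : ChainSp G) (h : ter e = ini (c.1 0)) (h' : ter (c.1 0) ≠ ini e) :
    ChainSp G :=
  ⟨fun n => Nat.casesOn n e c.1, fun i => by
    cases i with
    | zero => exact ⟨h, h'⟩
    | succ i => exact c.2 i⟩

theorem shift_cons (e : DE G) (c : ChainSp G) (h h') : shift G (cons e c h h') = c := rfl

theorem ChainSp.ext_ini {c c' : ChainSp G} (h : ∀ n, ini (c.1 n) = ini (c'.1 n)) : c = c' := by
  refine Subtype.ext (funext fun n => DE.ext (h n) ?_)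
  rw [(c.2 n).1, (c'.2 n).1, h]

theorem endB_shift (hT : G.IsTree) (c : ChainSp G) : endB G (shift G c) = endB G c := by
  refine Quot.sound ?_
  refine (infinite_range_of_injective ((toRay G (shift G c)).2.injective hT)).mono ?_
  rintro _ ⟨n, rfl⟩
  exact ⟨⟨n, rfl⟩, ⟨n + 1, rfl⟩⟩

theorem endB_cons (hT : G.IsTree) (e : DE G) (c : ChainSp G) (h h') :
    endB G (cons e c h h') = endB G c := by
  rw [← endB_shift hT, shift_cons]

theorem ChainSp.eq_of_endB_eq (hT : G.IsTree) {c c' : ChainSp G}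
    (h0 : ini (c.1 0) = ini (c'.1 0)) (h : endB G c = endB G c') : c = c' := by
  obtain ⟨m, n, hmn⟩ := exists_tail_eq_of_mk_eq hT h
  refine ChainSp.ext_ini fun k => ?_
  exact ((toRay G c).2.eq_of_le hT (toRay G c').2 h0 (hmn k)).2 k (Nat.le_add_left k m)

theorem exists_chain (hT : G.IsTree) (x : X) (ω : Boundary G) :
    ∃ c : ChainSp G, ini (c.1 0) = x ∧ endB G c = ω := by
  induction ω using Quot.ind with
  | mk r =>
  suffices ∀ {y z : X} (_ : G.Walk y z) (c : ChainSp G), ini (c.1 0) = y →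
      ∃ c' : ChainSp G, ini (c'.1 0) = z ∧ endB G c' = endB G c from
    this (hT.connected.preconnected (r.1 0) x).some (ofRay r) rfl
  intro y z p
  induction p with
  | nil => exact fun c hc => ⟨c, hc, rfl⟩
  | @cons u v w huv _ ih =>
    intro c hc
    by_cases hv : ter (c.1 0) = v
    · obtain ⟨c', h1, h2⟩ := ih (shift G c) ((c.2 0).1.symm.trans hv)
      exact ⟨c', h1, h2.trans (endB_shift hT c)⟩
    · obtain ⟨c', h1, h2⟩ := ih (cons ⟨(v, u), huv.symm⟩ c hc.symm hv) rfl
      exact ⟨c', h1, h2.trans (endB_cons hT ..)⟩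

/-- The chain with a given initial vertex and endpoint. -/
noncomputable def chain (hT : G.IsTree) (x : X) (ω : Boundary G) : ChainSp G :=
  (exists_chain hT x ω).choose

theorem ini_chain (hT : G.IsTree) (x : X) (ω : Boundary G) : ini ((chain hT x ω).1 0) = x :=
  (exists_chain hT x ω).choose_spec.1

theorem endB_chain (hT : G.IsTree) (x : X) (ω : Boundary G) : endB G (chain hT x ω) = ω :=
  (exists_chain hT x ω).choose_spec.2

theorem chain_ini_endB (hT : G.IsTree) (c : ChainSp G) :
    chain hT (ini (c.1 0)) (endB G c) = c :=
  ChainSp.eq_of_endB_eq hT (ini_chain ..) (endB_chain ..)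

theorem mem_plusBd_iff {e : DE G} {ω : Boundary G} :
    ω ∈ plusBd G e ↔ ∃ c : ChainSp G, endB G c = ω ∧ c.1 0 = e := by
  constructor
  · rintro ⟨r, rfl, h0, h1⟩
    exact ⟨ofRay r, rfl, DE.ext h0 h1⟩
  · rintro ⟨c, rfl, rfl⟩
    exact ⟨toRay G c, rfl, rfl, ((c.2 0).1).symm⟩

theorem endB_mem_plusBd_iff (hT : G.IsTree) {e : DE G} {c : ChainSp G}
    (h : ini (c.1 0) = ini e) : endB G c ∈ plusBd G e ↔ c.1 0 = e := by
  refine ⟨fun hc => ?_, fun hc => mem_plusBd_iff.2 ⟨c, rfl, hc⟩⟩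
  obtain ⟨d, hd, rfl⟩ := mem_plusBd_iff.1 hc
  rw [ChainSp.eq_of_endB_eq hT h hd.symm]

theorem compl_plusBd (hT : G.IsTree) (e : DE G) : (plusBd G e)ᶜ = plusBd G (op e) := by
  ext ω
  obtain ⟨c, hc, rfl⟩ := exists_chain hT (ini e) ω
  rw [mem_compl_iff, endB_mem_plusBd_iff hT hc]
  constructor
  · intro h
    refine mem_plusBd_iff.2 ⟨cons (op e) c hc.symm fun h' => h (DE.ext hc h'), ?_, rfl⟩
    exact endB_cons hT ..
  · rintro h h'
    obtain ⟨d, hd, hd0⟩ := mem_plusBd_iff.1 h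
    have hdc : shift G d = c := by
      refine ChainSp.eq_of_endB_eq hT ?_ ((endB_shift hT d).trans hd)
      rw [hc]
      change ini (d.1 1) = _
      rw [← (d.2 0).1, hd0]
      rfl
    have := (d.2 0).2
    change ter ((shift G d).1 0) ≠ _ at this
    rw [hdc, h', hd0] at this
    exact this rfl

/-- An initial segment of a chain can be continued by any chain through its last edge. -/
theorem exists_splice (hT : G.IsTree) (c : ChainSp G) (n : ℕ) (d : ChainSp G)
    (h : d.1 0 = c.1 n) : ∃ c' : ChainSp G, endB G c' = endB G d ∧ ∀ i ≤ n, c'.1 i = c.1 i := by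
  induction n generalizing c with
  | zero => exact ⟨d, rfl, fun i hi => by obtain rfl : i = 0 := by omega
                                          exact h⟩
  | succ n ih =>
    obtain ⟨c', h1, h2⟩ := ih (shift G c) h
    have h0 : c'.1 0 = c.1 1 := h2 0 (Nat.zero_le n)
    refine ⟨cons (c.1 0) c' (by rw [h0, (c.2 0).1]) (by rw [h0]; exact (c.2 0).2),
      (endB_cons hT ..).trans h1, fun i hi => ?_⟩
    cases i with
    | zero => rfl
    | succ i => exact h2 i (by omega)

theorem endB_mem_plusBd (hT : G.IsTree) (c : ChainSp G) (n : ℕ) :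
    endB G c ∈ plusBd G (c.1 n) := by
  induction n generalizing c with
  | zero => exact mem_plusBd_iff.2 ⟨c, rfl, rfl⟩
  | succ n ih => exact endB_shift hT c ▸ ih (shift G c)

/-! ### Topology of the boundary and of the shift space -/

theorem isOpen_plusBd (e : DE G) : IsOpen (plusBd G e) :=
  TopologicalSpace.isOpen_generateFrom_of_mem ⟨e, rfl⟩

theorem isClopen_plusBd (hT : G.IsTree) (e : DE G) : IsClopen (plusBd G e) :=
  ⟨⟨compl_plusBd hT e ▸ isOpen_plusBd _⟩, isOpen_plusBd e⟩

theorem isOpen_cylinder (c : ChainSp G) (n : ℕ) :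
    IsOpen {d : ChainSp G | ∀ i ≤ n, d.1 i = c.1 i} :=
  TopologicalSpace.isOpen_generateFrom_of_mem ⟨c, n, rfl⟩

theorem isLocallyConstant_first : IsLocallyConstant fun c : ChainSp G => c.1 0 :=
  (IsLocallyConstant.iff_exists_open _).2 fun c =>
    ⟨_, isOpen_cylinder c 0, fun _ _ => rfl, fun _ hd => hd 0 le_rfl⟩

theorem continuous_endB (hT : G.IsTree) : Continuous (endB G) := by
  refine continuous_generateFrom_iff.2 ?_
  rintro _ ⟨e, rfl⟩
  refine isOpen_iff_forall_mem_open.2 fun c hc => ?_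
  obtain ⟨d, hd, rfl⟩ := mem_plusBd_iff.1 hc
  obtain ⟨m, n, hmn⟩ := exists_tail_eq_of_mk_eq hT hd.symm
  refine ⟨_, fun c' hc' => ?_, isOpen_cylinder c m, fun _ _ => rfl⟩
  have h1 : c.1 m = d.1 n := by
    refine DE.ext (hmn 0) ?_
    rw [(c.2 m).1, (d.2 n).1]
    exact hmn 1
  obtain ⟨d', hd', hd0'⟩ := mem_plusBd_iff.1 (endB_mem_plusBd hT c' m)
  obtain ⟨c'', h2, h3⟩ := exists_splice hT d n d' (by rw [hd0', hc' m le_rfl, h1])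
  exact mem_plusBd_iff.2 ⟨c'', h2.trans hd', h3 0 (Nat.zero_le n)⟩

theorem continuous_chain (hT : G.IsTree) (x : X) : Continuous (chain hT x) := by
  refine continuous_generateFrom_iff.2 ?_
  rintro _ ⟨c, n, rfl⟩
  refine isOpen_iff_forall_mem_open.2 fun ω hω => ?_
  rw [mem_preimage, mem_ofPred_eq] at hω
  refine ⟨plusBd G (c.1 n), fun ω' hω' => ?_, isOpen_plusBd _, ?_⟩
  · obtain ⟨d, rfl, hd⟩ := mem_plusBd_iff.1 hω'
    obtain ⟨c', h1, h2⟩ := exists_splice hT c n d hd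
    have h3 : ini (c'.1 0) = x := by
      rw [h2 0 (Nat.zero_le n), ← hω 0 (Nat.zero_le n), ini_chain]
    rw [mem_preimage, ← h1, ← h3, chain_ini_endB]
    exact h2
  · have := endB_mem_plusBd hT (chain hT x ω) n
    rwa [endB_chain, hω n le_rfl] at this

theorem isCompact_setOf_ini_eq (hlf : LocFin G) (x : X) :
    IsCompact {c : ChainSp G | ini (c.1 0) = x} := by
  let _ : TopologicalSpace (DE G) := ⊥
  have : DiscreteTopology (DE G) := ⟨rfl⟩
  let A : ℕ → Set (DE G) := fun n =>
    Nat.rec {e | ini e = x} (fun _ s => ⋃ e' ∈ s, {e | ini e = ter e'}) n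
  have hA : ∀ n, (A n).Finite := by
    intro n
    induction n with
    | zero => exact hlf x
    | succ n ih => exact ih.biUnion fun e _ => hlf (ter e)
  let K : Set (ℕ → DE G) := {c | IsChainSeq G c ∧ ini (c 0) = x}
  have hKA : K ⊆ univ.pi A := by
    rintro c ⟨hc, hc0⟩ n -
    induction n with
    | zero => exact hc0
    | succ n ih => exact mem_biUnion ih (hc n).1.symm
  have hK : IsClosed K := by
    refine IsClosed.inter ?_ ?_
    · have h : {c | IsChainSeq G c} = ⋂ i, (fun c : ℕ → DE G => (c i, c (i + 1))) ⁻¹'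
          {p | ter p.1 = ini p.2 ∧ ter p.2 ≠ ini p.1} := by
        ext c
        simp [IsChainSeq]
      change IsClosed {c | IsChainSeq G c}
      rw [h]
      exact isClosed_iInter fun i => (isClosed_discrete _).preimage
        ((continuous_apply i).prodMk (continuous_apply (i + 1)))
    · exact (isClosed_discrete {e : DE G | ini e = x}).preimage
        (continuous_apply (A := fun _ : ℕ => DE G) 0)
  have hKc : IsCompact K :=
    (isCompact_univ_pi fun n => (hA n).isCompact).of_isClosed_subset hK hKA
  let φ : K → ChainSp G := fun c => ⟨c.1, c.2.1⟩
  have hφ : Continuous φ := by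
    refine continuous_generateFrom_iff.2 ?_
    rintro _ ⟨c, n, rfl⟩
    have h : φ ⁻¹' {d : ChainSp G | ∀ i ≤ n, d.1 i = c.1 i} =
        ⋂ i ∈ Iic n, (fun d : K => d.1 i) ⁻¹' {c.1 i} := by
      ext d
      simp [φ]
    rw [h]
    exact (finite_Iic n).isOpen_biInter fun i _ => (isOpen_discrete _).preimage
      ((continuous_apply i).comp continuous_subtype_val)
  have hr : {c : ChainSp G | ini (c.1 0) = x} = range φ := by
    ext c
    exact ⟨fun h => ⟨⟨c.1, c.2, h⟩, rfl⟩, fun ⟨d, hd⟩ => hd ▸ d.2.2⟩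
  rw [hr]
  have := isCompact_iff_compactSpace.1 hKc
  exact isCompact_range hφ

theorem isClosed_setOf_ini_eq (x : X) : IsClosed {c : ChainSp G | ini (c.1 0) = x} :=
  (isLocallyConstant_first.comp ini).isClosed_fiber x

/-! ### Functions supported on the chains starting at a vertex -/

/-- Transport of a function on the boundary to the chains starting at the vertex `x`. -/
noncomputable def vertexLift (x : X) (g : Boundary G → ℂ) (c : ChainSp G) : ℂ :=
  if ini (c.1 0) = x then g (endB G c) else 0

theorem vertexLift_chain (hT : G.IsTree) (x : X) (g : Boundary G → ℂ) (ω : Boundary G) :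
    vertexLift x g (chain hT x ω) = g ω := by
  rw [vertexLift, if_pos (ini_chain ..), endB_chain]

theorem vertexLift_mem (hT : G.IsTree) (hlf : LocFin G) (x : X) {g : Boundary G → ℂ}
    (hg : IsLocallyConstant g) : vertexLift x g ∈ CcP G := by
  refine ⟨?_, ?_⟩
  · exact (isLocallyConstant_first.comp ini).comp₂ (hg.comp_continuous (continuous_endB hT))
      fun v z => if v = x then z else 0
  · refine (isCompact_setOf_ini_eq hlf x).of_isClosed_subset (isClosed_tsupport _)
      (closure_minimal (fun c hc => ?_) (isClosed_setOf_ini_eq x))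
    by_contra h
    exact hc (if_neg h)

/-- `vertexLift` as a linear map on locally constant functions. -/
noncomputable def vertexLiftLin (hT : G.IsTree) (hlf : LocFin G) (x : X) : Clc G →ₗ[ℂ] CcP G where
  toFun g := ⟨vertexLift x g.1, vertexLift_mem hT hlf x g.2⟩
  map_add' g h := by
    refine Subtype.ext (funext fun c => ?_)
    change vertexLift x (g.1 + h.1) c = vertexLift x g.1 c + vertexLift x h.1 c
    simp only [vertexLift]
    split_ifs <;> simp
  map_smul' a g := by
    refine Subtype.ext (funext fun c => ?_)
    change vertexLift x (a • g.1) c = a • vertexLift x g.1 c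
    simp only [vertexLift]
    split_ifs <;> simp

theorem finsum_mem_eq_indicator_of_forall_ne {α M : Type*} [AddCommMonoid M] {f : α → M}
    (s : Set α) (a : α) (h : ∀ b ∈ s, b ≠ a → f b = 0) : ∑ᶠ b ∈ s, f b = indicator s f a := by
  rw [finsum_mem_def]
  exact finsum_eq_single _ a fun b hb => indicator_apply_eq_zero.2 fun hs => h b hs hb

theorem finsum_mem_finset_sum_of_forall_ne {ι α M : Type*} [AddCommMonoid M] (S : Finset ι)
    {f : ι → α → M} (s : Set α) (a : ι → α) (h : ∀ i, ∀ b ∈ s, b ≠ a i → f i b = 0) :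
    ∑ᶠ b ∈ s, (∑ i ∈ S, f i) b = ∑ i ∈ S, ∑ᶠ b ∈ s, f i b := by
  rw [finsum_mem_def, Finset.indicator_sum]
  simp only [finsum_mem_def, Finset.sum_apply]
  refine finsum_sum_comm S (fun b i => indicator s (f i) b) fun i _ =>
    (finite_singleton (a i)).subset fun b hb => ?_
  by_contra hne
  exact hb (indicator_apply_eq_zero.2 fun hs => h i b hs hne)

theorem vertexLift_eq_zero_of_endB_eq (hT : G.IsTree) (x : X) (g : Boundary G → ℂ)
    {ω : Boundary G} {c : ChainSp G} (hc : endB G c = ω) (hne : c ≠ chain hT x ω) :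
    vertexLift x g c = 0 :=
  if_neg fun hx => hne (by rw [← hx, ← hc, chain_ini_endB])

theorem push_vertexLift (hT : G.IsTree) (x : X) (g : Boundary G → ℂ) :
    push G (vertexLift x g) = g := by
  funext ω
  rw [push, finsum_mem_eq_indicator_of_forall_ne {c | endB G c = ω} (chain hT x ω) fun c hc =>
    vertexLift_eq_zero_of_endB_eq hT x g hc, indicator_of_mem
    (show chain hT x ω ∈ {c | endB G c = ω} from endB_chain hT x ω), vertexLift_chain]

theorem push_sum_vertexLift (hT : G.IsTree) {ι : Type*} (S : Finset ι) (x : ι → X)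
    (h : ι → Boundary G → ℂ) : push G (∑ i ∈ S, vertexLift (x i) (h i)) = ∑ i ∈ S, h i := by
  funext ω
  rw [push, finsum_mem_finset_sum_of_forall_ne S {c | endB G c = ω} (fun i => chain hT (x i) ω)
    fun i c hc => vertexLift_eq_zero_of_endB_eq hT (x i) (h i) hc, Finset.sum_apply]
  exact Finset.sum_congr rfl fun i _ => congrFun (push_vertexLift hT (x i) (h i)) ω

theorem transfer_vertexLift (hT : G.IsTree) (e : DE G) {h : Boundary G → ℂ}
    (hh : ∀ ω ∉ plusBd G e, h ω = 0) :
    transfer G (vertexLift (ini e) h) = vertexLift (ter e) h := by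
  funext c
  rw [transfer, finsum_mem_eq_indicator_of_forall_ne {d | shift G d = c}
    (chain hT (ini e) (endB G c)) fun d hd =>
    vertexLift_eq_zero_of_endB_eq hT (ini e) h ((endB_shift hT d).symm.trans (congrArg _ hd)),
    indicator_apply, vertexLift_chain, vertexLift]
  by_cases hω : endB G c ∈ plusBd G e
  · have h0 : (chain hT (ini e) (endB G c)).1 0 = e := by
      rwa [← endB_mem_plusBd_iff hT (ini_chain ..), endB_chain]
    have h1 : ini ((shift G (chain hT (ini e) (endB G c))).1 0) = ter e := by
      rw [← h0, ((chain hT (ini e) (endB G c)).2 0).1, h0]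
      rfl
    refine if_congr ⟨fun hc => ?_, fun hc => ?_⟩ rfl rfl
    · rw [← h1, show shift G _ = c from hc]
    · exact ChainSp.eq_of_endB_eq hT (h1.trans hc.symm) (by rw [endB_shift hT, endB_chain])
  · simp [hh _ hω]

theorem transfer_sum_vertexLift (hT : G.IsTree) (S : Finset (DE G)) {h : DE G → Boundary G → ℂ}
    (hh : ∀ e, ∀ ω ∉ plusBd G e, h e ω = 0) :
    transfer G (∑ e ∈ S, vertexLift (ini e) (h e)) = ∑ e ∈ S, vertexLift (ter e) (h e) := by
  funext c
  rw [transfer, finsum_mem_finset_sum_of_forall_ne S {d | shift G d = c}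
    (fun e => chain hT (ini e) (endB G c))
    fun e d hd => vertexLift_eq_zero_of_endB_eq hT (ini e) (h e)
      ((endB_shift hT d).symm.trans (congrArg _ hd)), Finset.sum_apply]
  exact Finset.sum_congr rfl fun e _ => congrFun (transfer_vertexLift hT e (hh e)) c

theorem IsLocallyConstant.indicator_plusBd (hT : G.IsTree) (e : DE G) {g : Boundary G → ℂ}
    (hg : IsLocallyConstant g) : IsLocallyConstant (indicator (plusBd G e) g) :=
  (LocallyConstant.indicator ⟨g, hg⟩ (isClopen_plusBd hT e)).isLocallyConstant

/-- Every locally constant compactly supported function on the shift space splits according to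
the first edge. -/
theorem exists_eq_sum_vertexLift (hT : G.IsTree) {f : ChainSp G → ℂ} (hf : f ∈ CcP G) :
    ∃ (S : Finset (DE G)) (h : DE G → Clc G), (∀ e, ∀ ω ∉ plusBd G e, (h e).1 ω = 0) ∧
      f = ∑ e ∈ S, vertexLift (ini e) (h e).1 := by
  have hS : ((fun c : ChainSp G => c.1 0) '' tsupport f).Finite := by
    let _ : TopologicalSpace (DE G) := ⊥
    have : DiscreteTopology (DE G) := ⟨rfl⟩
    exact (IsCompact.image hf.2 isLocallyConstant_first.continuous).finite_of_discrete
  refine ⟨hS.toFinset, fun e => ⟨indicator (plusBd G e) (f ∘ chain hT (ini e)),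
    IsLocallyConstant.indicator_plusBd hT e (hf.1.comp_continuous (continuous_chain hT _))⟩,
    fun e ω hω => indicator_of_notMem hω _, ?_⟩
  funext c
  have key : ∀ e, vertexLift (ini e) (indicator (plusBd G e) (f ∘ chain hT (ini e))) c =
      if c.1 0 = e then f c else 0 := by
    intro e
    by_cases h : ini (c.1 0) = ini e
    · rw [vertexLift, if_pos h, indicator_apply]
      refine if_congr (endB_mem_plusBd_iff hT h) ?_ rfl
      rw [comp_apply, ← h, chain_ini_endB]
    · rw [vertexLift, if_neg h, if_neg fun h' => h (congrArg ini h')]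
  simp only [Finset.sum_apply, key, Finset.sum_ite_eq]
  split_ifs with h
  · rfl
  · by_contra hc
    exact h (hS.mem_toFinset.2 ⟨c, subset_tsupport _ hc, rfl⟩)

theorem pairB_of_mem (T : DualB G) (g : Clc G) : pairB G T g.1 = T g :=
  dif_pos g.2

theorem pairP_of_mem (lam : DualP G) (f : CcP G) : pairP G lam f.1 = lam f :=
  dif_pos f.2

theorem vertexLiftLin_eq_of_adj (hT : G.IsTree) (hlf : LocFin G) {lam : DualP G}
    (hlam : ∀ f : CcP G, pairP G lam (transfer G f.1) = lam f) (e : DE G) (g : Clc G) :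
    lam (vertexLiftLin hT hlf (ini e) g) = lam (vertexLiftLin hT hlf (ter e) g) := by
  have key : ∀ (e : DE G) (g : Clc G), (∀ ω ∉ plusBd G e, g.1 ω = 0) →
      lam (vertexLiftLin hT hlf (ini e) g) = lam (vertexLiftLin hT hlf (ter e) g) := by
    intro e g hg
    rw [← hlam, ← pairP_of_mem]
    exact congrArg _ (transfer_vertexLift hT e hg)
  let g₁ : Clc G := ⟨indicator (plusBd G e) g.1, IsLocallyConstant.indicator_plusBd hT e g.2⟩
  let g₂ : Clc G :=
    ⟨indicator (plusBd G (op e)) g.1, IsLocallyConstant.indicator_plusBd hT (op e) g.2⟩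
  have hg : g = g₁ + g₂ := by
    refine Subtype.ext ?_
    change g.1 = indicator (plusBd G e) g.1 + indicator (plusBd G (op e)) g.1
    rw [← compl_plusBd hT, indicator_self_add_compl]
  have h₁ := key e g₁ fun ω hω => indicator_of_notMem hω _
  have h₂ := key (op e) g₂ fun ω hω => indicator_of_notMem hω _
  rw [hg, map_add, map_add, map_add, map_add, h₁]
  exact congrArg _ h₂.symm

theorem vertexLiftLin_eq (hT : G.IsTree) (hlf : LocFin G) {lam : DualP G}
    (hlam : ∀ f : CcP G, pairP G lam (transfer G f.1) = lam f) (x y : X) (g : Clc G) :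
    lam (vertexLiftLin hT hlf x g) = lam (vertexLiftLin hT hlf y g) := by
  induction (hT.connected.preconnected x y).some with
  | nil => rfl
  | cons h _ ih => exact (vertexLiftLin_eq_of_adj hT hlf hlam ⟨(_, _), h⟩ g).trans ih

theorem coe_sum_vertexLiftLin (hT : G.IsTree) (hlf : LocFin G) {ι : Type*} (S : Finset ι)
    (x : ι → X) (h : ι → Clc G) : (∑ i ∈ S, vertexLiftLin hT hlf (x i) (h i) : CcP G).1 =
      ∑ i ∈ S, vertexLift (x i) (h i).1 := by
  rw [Submodule.coe_sum]
  rfl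

end Tree

/-- A functional `λ ∈ D'(𝔓)` is of the form `B* T` iff `L' λ = λ`;
moreover `B*` is injective, hence a linear isomorphism from `D'(Ω)` onto the fixed points
of the transpose transfer operator. -/
theorem statement9 {X : Type} (G : SimpleGraph X) (hT : G.IsTree) (hlf : LocFin G)
    (hnd : ∀ x : X, 2 ≤ deg G x) :
    (∀ lam : DualP G,
      (∃ T : DualB G, ∀ f : ↥(CcP G), lam f = pairB G T (push G f.1)) ↔
        (∀ f : ↥(CcP G), pairP G lam (transfer G f.1) = lam f)) ∧
    (∀ T T' : DualB G,
      (∀ f : ↥(CcP G), pairB G T (push G f.1) = pairB G T' (push G f.1)) → T = T') := by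
  have hpush : ∀ f : CcP G, ∃ (S : Finset (DE G)) (h : DE G → Clc G),
      (∀ e, ∀ ω ∉ plusBd G e, (h e).1 ω = 0) ∧
        f = ∑ e ∈ S, vertexLiftLin hT hlf (ini e) (h e) ∧
        push G f.1 = (∑ e ∈ S, h e : Clc G).1 := by
    intro f
    obtain ⟨S, h, hh, hf⟩ := exists_eq_sum_vertexLift hT f.2
    refine ⟨S, h, hh, Subtype.ext (by rw [coe_sum_vertexLiftLin, hf]), ?_⟩
    rw [hf, push_sum_vertexLift hT, Submodule.coe_sum]
  refine ⟨fun lam => ⟨?_, fun hlam => ?_⟩, fun T T' h => LinearMap.ext fun g => ?_⟩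
  · rintro ⟨T, hlam⟩ f
    obtain ⟨S, h, hh, hf, hp⟩ := hpush f
    have ht : transfer G f.1 = (∑ e ∈ S, vertexLiftLin hT hlf (ter e) (h e) : CcP G).1 := by
      rw [hf, coe_sum_vertexLiftLin, transfer_sum_vertexLift hT S hh, coe_sum_vertexLiftLin]
    rw [ht, pairP_of_mem, hlam, hlam, hp, coe_sum_vertexLiftLin, push_sum_vertexLift hT,
      Submodule.coe_sum]
  · obtain ⟨o⟩ := hT.connected.nonempty
    refine ⟨lam ∘ₗ vertexLiftLin hT hlf o, fun f => ?_⟩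
    obtain ⟨S, h, -, hf, hp⟩ := hpush f
    rw [hp, pairB_of_mem, hf, map_sum, map_sum]
    exact Finset.sum_congr rfl fun e _ => vertexLiftLin_eq hT hlf hlam _ _ _
  · obtain ⟨o⟩ := hT.connected.nonempty
    have := h (vertexLiftLin hT hlf o g)
    rwa [show push G (vertexLiftLin hT hlf o g).1 = g.1 from push_vertexLift hT o g.1,
      pairB_of_mem, pairB_of_mem] at this

end GraphQCC
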